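/- Fix y > 0 and c > 1. Then the limit as X → ∞ of P₋(y, X, c) := (log X / X) · Σ_{N prime, X ≤ N ≤ cX} Σ_{χ ∈ D₋(N)} χ(⌈yX⌉^𝔭)/τ(χ) exists and equals −i · ∫_1^c sin(2πy/x) dx. -/

import Mathlib

open Filter Topology Finset

/-- `⌈x⌉^𝔭`: the smallest prime number that is `≥ x`. -/
noncomputable def leastPrime (x : ℝ) : ℕ := sInf {p : ℕ | p.Prime ∧ x ≤ (p : ℝ)}

/-- The Gauss sum `τ(χ) = Σ_{b=1}^{N} χ(b) e^{2πib/N}`. -/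
noncomputable def gaussSum' {N : ℕ} (χ : DirichletCharacter ℂ N) : ℂ :=
  ∑ b ∈ Finset.Icc 1 N,
    χ ((b : ℕ) : ZMod N) * Complex.exp (2 * Real.pi * Complex.I * (b : ℂ) / (N : ℂ))

/-- `P₋(y, X, c)`. -/
noncomputable def Pminus (y X c : ℝ) : ℂ :=
  (Complex.ofReal (Real.log X / X)) *
    ∑ N ∈ (Finset.range (Nat.floor (c * X) + 1)).filter
        (fun N : ℕ => N.Prime ∧ X ≤ (N : ℝ) ∧ (N : ℝ) ≤ c * X),
      ∑ᶠ χ ∈ {χ : DirichletCharacter ℂ N | χ.IsPrimitive ∧ χ (-1) = -1},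
        χ ((leastPrime (y * X) : ℕ) : ZMod N) / gaussSum' χ

section Fejer

open MeasureTheory

/-- The Fejér kernel `2 (1 - cos v) / v²`. -/
noncomputable def fejer (v : ℝ) : ℝ := 2 * (1 - Real.cos v) / v ^ 2

lemma fejer_nonneg (v : ℝ) : 0 ≤ fejer v :=
  div_nonneg (by linarith [Real.cos_le_one v]) (sq_nonneg v)

lemma fejer_le (v : ℝ) : fejer v ≤ 8 * (1 + v ^ 2)⁻¹ := by
  rcases eq_or_ne v 0 with rfl | hv
  · simp [fejer]
  have h2 : 0 < v ^ 2 := by positivity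
  rw [fejer, ← div_eq_mul_inv, div_le_div_iff₀ h2 (by positivity)]
  have h1 := Real.one_sub_sq_div_two_le_cos (x := v)
  have h3 := Real.neg_one_le_cos v
  rcases le_total (v ^ 2) 1 with h | h <;> nlinarith

lemma measurable_fejer : Measurable fejer := by
  unfold fejer; fun_prop

lemma integrable_fejer : Integrable fejer := by
  refine (integrable_inv_one_add_sq.const_mul 8).mono' measurable_fejer.aestronglyMeasurable ?_
  filter_upwards with v
  rw [Real.norm_of_nonneg (fejer_nonneg v)]
  exact fejer_le v

lemma integral_fejer_pos : 0 < ∫ v, fejer v := by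
  rw [integral_pos_iff_support_of_nonneg fejer_nonneg integrable_fejer]
  refine lt_of_lt_of_le (b := volume (Set.Ioo (0 : ℝ) 1)) (by simp) (measure_mono fun v hv => ?_)
  have h1 : Real.cos v < 1 := by
    rw [← Real.cos_zero]
    exact Real.cos_lt_cos_of_nonneg_of_le_pi_div_two le_rfl
      (by linarith [hv.2, Real.pi_gt_three]) hv.1
  have h2 : 0 < v := hv.1
  exact (div_pos (by linarith) (by positivity)).ne'

/-- The Fourier transform of the triangle function of half-width `l`. -/
lemma integral_triangle_mul_exp {l v : ℝ} (hl : 0 < l) (hv : v ≠ 0) :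
    ∫ t in (-l)..l, ((1 - |t| / l : ℝ) : ℂ) * Complex.exp (-(t * v * Complex.I)) =
      ((l * fejer (l * v) : ℝ) : ℂ) := by
  have hlC : (l : ℂ) ≠ 0 := by exact_mod_cast hl.ne'
  have hvC : (v : ℂ) ≠ 0 := by exact_mod_cast hv
  have hI := Complex.I_ne_zero
  have key (σ : ℝ) (a b : ℝ) : ∫ t in a..b, (1 - σ * t / l : ℂ) * Complex.exp (-(t * v * Complex.I))
      = ((1 - σ * b / l) * Complex.I / v * Complex.exp (-(b * v * Complex.I))
          - σ / (l * v ^ 2) * Complex.exp (-(b * v * Complex.I)))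
        - ((1 - σ * a / l) * Complex.I / v * Complex.exp (-(a * v * Complex.I))
          - σ / (l * v ^ 2) * Complex.exp (-(a * v * Complex.I))) := by
    refine intervalIntegral.integral_eq_sub_of_hasDerivAt
      (f := fun t : ℝ => (1 - σ * t / l) * Complex.I / v * Complex.exp (-(t * v * Complex.I))
          - σ / (l * v ^ 2) * Complex.exp (-(t * v * Complex.I))) (fun t _ => ?_) ?_
    · have h0 : HasDerivAt (fun t : ℝ => (t : ℂ)) 1 t := Complex.ofRealCLM.hasDerivAt
      have he := ((h0.mul_const (v : ℂ)).mul_const Complex.I).fun_neg.cexp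
      have h1 := ((((h0.const_mul (σ : ℂ)).div_const (l : ℂ)).const_sub 1).mul_const Complex.I).div_const (v : ℂ)
      have := (h1.mul he).sub (he.const_mul ((σ : ℂ) / (l * v ^ 2)))
      refine this.congr_deriv ?_
      field_simp
      ring_nf
      simp only [Complex.I_sq]
      ring
    · apply Continuous.intervalIntegrable; fun_prop
  have hcont : Continuous fun t : ℝ => ((1 - |t| / l : ℝ) : ℂ) * Complex.exp (-(t * v * Complex.I)) := by
    fun_prop
  rw [← intervalIntegral.integral_add_adjacent_intervals (b := 0)
    (hcont.intervalIntegrable _ _) (hcont.intervalIntegrable _ _)]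
  have e1 : ∫ t in (-l)..0, ((1 - |t| / l : ℝ) : ℂ) * Complex.exp (-(t * v * Complex.I)) =
      ∫ t in (-l)..0, (1 - (-1 : ℝ) * t / l : ℂ) * Complex.exp (-(t * v * Complex.I)) := by
    refine intervalIntegral.integral_congr fun t ht => ?_
    rw [Set.uIcc_of_le (by linarith)] at ht
    simp only [abs_of_nonpos ht.2]; push_cast; ring
  have e2 : ∫ t in (0)..l, ((1 - |t| / l : ℝ) : ℂ) * Complex.exp (-(t * v * Complex.I)) =
      ∫ t in (0)..l, (1 - (1 : ℝ) * t / l : ℂ) * Complex.exp (-(t * v * Complex.I)) := by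
    refine intervalIntegral.integral_congr fun t ht => ?_
    rw [Set.uIcc_of_le hl.le] at ht
    simp only [abs_of_nonneg ht.1]; push_cast; ring
  rw [e1, e2, key, key]
  have hc : (Complex.cos (l * v)) = (Complex.exp (l * v * Complex.I) +
      Complex.exp (-(l * v * Complex.I))) / 2 := by rw [Complex.cos, neg_mul]
  rw [fejer]
  push_cast
  rw [hc]
  simp only [zero_mul, neg_zero, Complex.exp_zero, neg_mul, neg_neg]
  field_simp
  ring

end Fejer

section Tauberian

open MeasureTheory

variable {b : ℝ → ℝ} {C : ℝ} {G : ℂ → ℂ}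

lemma integral_triangle_mul_laplace (hb : Measurable b) (hC : ∀ u, |b u| ≤ C)
    (hG : ∀ z : ℂ, 0 < z.re → ∫ u in Set.Ioi (0 : ℝ), (b u : ℂ) * Complex.exp (-(z * u)) = G z)
    {l : ℝ} (hl : 0 < l) (x : ℝ) {ε : ℝ} (hε : 0 < ε) :
    ∫ t in (-l)..l, ((1 - |t| / l : ℝ) : ℂ) * Complex.exp (t * x * Complex.I) *
        G (ε + t * Complex.I) =
      ∫ u in Set.Ioi (0 : ℝ), ((b u * Real.exp (-(ε * u)) * (l * fejer (l * (u - x))) : ℝ) : ℂ) := by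
  have hint : Integrable (Function.uncurry fun t u : ℝ =>
      ((1 - |t| / l : ℝ) : ℂ) * Complex.exp (t * x * Complex.I) *
        ((b u : ℂ) * Complex.exp (-((ε + t * Complex.I) * u))))
      ((volume.restrict (Set.Ioc (-l) l)).prod (volume.restrict (Set.Ioi 0))) := by
    have h1 : Integrable (fun _ : ℝ => (1 : ℝ)) (volume.restrict (Set.Ioc (-l) l)) :=
      integrable_const _
    have h2 : Integrable (fun u : ℝ => C * Real.exp (-ε * u)) (volume.restrict (Set.Ioi 0)) :=
      (integrableOn_exp_mul_Ioi (by linarith : -ε < 0) 0).const_mul C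
    refine (h1.mul_prod h2).mono' ?_ ?_
    · apply Measurable.aestronglyMeasurable
      unfold Function.uncurry
      fun_prop
    · rw [Measure.prod_restrict]
      refine (ae_restrict_iff' (measurableSet_Ioc.prod measurableSet_Ioi)).2 (ae_of_all _ ?_)
      rintro ⟨t, u⟩ ⟨ht, hu⟩
      simp only [Set.mem_Ioc, Set.mem_Ioi] at ht hu
      have habs : |t| ≤ l := abs_le.2 ⟨ht.1.le, ht.2⟩
      have hK : |1 - |t| / l| ≤ 1 := by
        have : |t| / l ≤ 1 := (div_le_one hl).2 habs
        have : 0 ≤ |t| / l := by positivity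
        rw [abs_le]; constructor <;> linarith
      simp only [Function.uncurry, norm_mul, Complex.norm_real, Complex.norm_exp, Real.norm_eq_abs]
      have e1 : (t * x * Complex.I : ℂ).re = 0 := by simp
      have e2 : (-((ε + t * Complex.I) * u) : ℂ).re = -ε * u := by simp
      rw [e1, e2, Real.exp_zero, mul_one]
      have := hC u
      gcongr
  have hswap := integral_integral_swap hint
  rw [intervalIntegral.integral_of_le (by linarith)]
  calc _ = ∫ t in Set.Ioc (-l) l, ∫ u in Set.Ioi (0 : ℝ),
          ((1 - |t| / l : ℝ) : ℂ) * Complex.exp (t * x * Complex.I) *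
        ((b u : ℂ) * Complex.exp (-((ε + t * Complex.I) * u))) := by
        refine integral_congr_ae (ae_of_all _ fun t => ?_)
        simp only
        rw [integral_const_mul, hG _ (by simpa using hε)]
    _ = _ := hswap
    _ = _ := by
        have hne : ∀ᵐ u : ℝ, u ≠ x := by simp [ae_iff]
        refine integral_congr_ae ?_
        filter_upwards [ae_restrict_of_ae hne] with u hu
        rw [Complex.ofReal_mul, ← integral_triangle_mul_exp hl (sub_ne_zero.2 hu),
          intervalIntegral.integral_of_le (by linarith), ← integral_const_mul]
        refine integral_congr_ae (ae_of_all _ fun t => ?_)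
        simp only
        push_cast
        have : Complex.exp (t * x * Complex.I) * Complex.exp (-((ε + t * Complex.I) * u)) =
            Complex.exp (-(ε * u)) * Complex.exp (-(t * (u - x) * Complex.I)) := by
          rw [← Complex.exp_add, ← Complex.exp_add]; congr 1; ring
        linear_combination (1 - |t| / l : ℂ) * b u * this

lemma integrable_mul_fejer {l : ℝ} (hl : 0 < l) (x : ℝ) :
    Integrable fun u => l * fejer (l * (u - x)) :=
  ((integrable_fejer.comp_mul_left' hl.ne').comp_sub_right x).const_mul l

lemma integral_triangle_mul_boundary (hb : Measurable b) (hC : ∀ u, |b u| ≤ C)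
    (hGc : ContinuousOn G {z | 0 ≤ z.re})
    (hG : ∀ z : ℂ, 0 < z.re → ∫ u in Set.Ioi (0 : ℝ), (b u : ℂ) * Complex.exp (-(z * u)) = G z)
    {l : ℝ} (hl : 0 < l) (x : ℝ) :
    ∫ t in (-l)..l, ((1 - |t| / l : ℝ) : ℂ) * Complex.exp (t * x * Complex.I) *
        G (t * Complex.I) =
      ∫ u in Set.Ioi (0 : ℝ), ((b u * (l * fejer (l * (u - x))) : ℝ) : ℂ) := by
  have hcomp : IsCompact (Set.Icc (0 : ℝ) 1 ×ˢ Set.Icc (-l) l) := isCompact_Icc.prod isCompact_Icc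
  have hGc' : ContinuousOn (fun p : ℝ × ℝ => G (p.1 + p.2 * Complex.I))
      (Set.Icc (0 : ℝ) 1 ×ˢ Set.Icc (-l) l) := by
    refine hGc.comp (by fun_prop) fun p hp => ?_
    simpa using hp.1.1
  obtain ⟨B, hB⟩ := hcomp.exists_bound_of_continuousOn hGc'
  have hslice (ε : ℝ) (h0 : 0 ≤ ε) (h1 : ε ≤ 1) :
      ContinuousOn (fun t : ℝ => G (ε + t * Complex.I)) (Set.Icc (-l) l) := by
    refine hGc'.comp (f := fun t : ℝ => (ε, t)) (by fun_prop) fun t ht => ⟨⟨h0, h1⟩, ht⟩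
  have hsmall : ∀ᶠ ε : ℝ in 𝓝[>] 0, 0 < ε ∧ ε ≤ 1 := by
    filter_upwards [Ioc_mem_nhdsGT (zero_lt_one' ℝ)] with ε hε using hε
  have hleft : Tendsto (fun ε : ℝ => ∫ t in (-l)..l, ((1 - |t| / l : ℝ) : ℂ) *
      Complex.exp (t * x * Complex.I) * G (ε + t * Complex.I)) (𝓝[>] 0)
      (𝓝 (∫ t in (-l)..l, ((1 - |t| / l : ℝ) : ℂ) * Complex.exp (t * x * Complex.I) *
        G (t * Complex.I))) := by
    refine intervalIntegral.tendsto_integral_filter_of_dominated_convergence (fun _ => B)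
      ?_ ?_ intervalIntegrable_const ?_
    · filter_upwards [hsmall] with ε hε
      rw [Set.uIoc_of_le (by linarith)]
      refine (ContinuousOn.aestronglyMeasurable ?_ measurableSet_Icc).mono_set
        Set.Ioc_subset_Icc_self
      exact (Continuous.continuousOn (by fun_prop)).mul (hslice ε hε.1.le hε.2)
    · filter_upwards [hsmall] with ε hε
      refine ae_of_all _ fun t ht => ?_
      rw [Set.uIoc_of_le (by linarith)] at ht
      have habs : |t| ≤ l := abs_le.2 ⟨ht.1.le, ht.2⟩
      have hK : |1 - |t| / l| ≤ 1 := by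
        have : |t| / l ≤ 1 := (div_le_one hl).2 habs
        have : 0 ≤ |t| / l := by positivity
        rw [abs_le]; constructor <;> linarith
      have e1 : (t * x * Complex.I : ℂ).re = 0 := by simp
      have h1 := hB (ε, t) ⟨⟨hε.1.le, hε.2⟩, ⟨ht.1.le, ht.2⟩⟩
      simp only [norm_mul, Complex.norm_real, Complex.norm_exp, Real.norm_eq_abs]
      rw [e1, Real.exp_zero, mul_one]
      exact (mul_le_of_le_one_left (norm_nonneg _) hK).trans h1
    · refine ae_of_all _ fun t ht => ?_
      rw [Set.uIoc_of_le (by linarith)] at ht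
      refine Tendsto.const_mul _ ?_
      have h0 := hGc (t * Complex.I) (by simp)
      refine h0.tendsto.comp (tendsto_nhdsWithin_iff.2 ⟨?_, ?_⟩)
      · have : Continuous fun ε : ℝ => (ε + t * Complex.I : ℂ) := by fun_prop
        simpa using (this.tendsto 0).mono_left nhdsWithin_le_nhds
      · filter_upwards [hsmall] with ε hε
        simpa using hε.1.le
  have hright : Tendsto (fun ε : ℝ => ∫ u in Set.Ioi (0 : ℝ),
      ((b u * Real.exp (-(ε * u)) * (l * fejer (l * (u - x))) : ℝ) : ℂ)) (𝓝[>] 0)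
      (𝓝 (∫ u in Set.Ioi (0 : ℝ), ((b u * (l * fejer (l * (u - x))) : ℝ) : ℂ))) := by
    have hf := measurable_fejer
    refine tendsto_integral_filter_of_dominated_convergence
      (fun u => C * (l * fejer (l * (u - x)))) ?_ ?_
      ((integrable_mul_fejer hl x).const_mul C).integrableOn ?_
    · refine Eventually.of_forall fun ε => Measurable.aestronglyMeasurable ?_
      fun_prop
    · filter_upwards [hsmall] with ε hε
      refine (ae_restrict_iff' measurableSet_Ioi).2 (ae_of_all _ fun u hu => ?_)
      have hu' : (0 : ℝ) < u := hu
      have h1 : Real.exp (-(ε * u)) ≤ 1 := Real.exp_le_one_iff.2 (by nlinarith [hε.1])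
      have h2 : 0 ≤ l * fejer (l * (u - x)) := mul_nonneg hl.le (fejer_nonneg _)
      rw [Complex.norm_real, Real.norm_eq_abs, abs_mul, abs_mul, Real.abs_exp, abs_of_nonneg h2]
      exact mul_le_mul_of_nonneg_right
        ((mul_le_of_le_one_right (abs_nonneg _) h1).trans (hC u)) h2
    · refine ae_of_all _ fun u => ?_
      have : Continuous fun ε : ℝ =>
          ((b u * Real.exp (-(ε * u)) * (l * fejer (l * (u - x))) : ℝ) : ℂ) := by fun_prop
      simpa using (this.tendsto 0).mono_left nhdsWithin_le_nhds
  refine tendsto_nhds_unique (hleft.congr' ?_) hright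
  filter_upwards [hsmall] with ε hε
  exact integral_triangle_mul_laplace hb hC hG hl x hε.1

lemma tendsto_integral_mul_fejer_of_laplace (hb : Measurable b) (hC : ∀ u, |b u| ≤ C)
    (hGc : ContinuousOn G {z | 0 ≤ z.re})
    (hG : ∀ z : ℂ, 0 < z.re → ∫ u in Set.Ioi (0 : ℝ), (b u : ℂ) * Complex.exp (-(z * u)) = G z)
    {l : ℝ} (hl : 0 < l) :
    Tendsto (fun x => ∫ u in Set.Ioi (0 : ℝ), b u * (l * fejer (l * (u - x)))) atTop (𝓝 0) := by
  have hRL := Real.tendsto_integral_exp_smul_cocompact ((Set.Ioc (-l) l).indicator fun t : ℝ =>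
    ((1 - |t| / l : ℝ) : ℂ) * G (t * Complex.I))
  have hlin : Tendsto (fun x : ℝ => -(x / (2 * Real.pi))) atTop (cocompact ℝ) :=
    (tendsto_neg_atTop_atBot.comp (tendsto_id.atTop_div_const (by positivity))).mono_right
      atBot_le_cocompact
  have := (Complex.continuous_re.tendsto _).comp (hRL.comp hlin)
  refine this.congr fun x => ?_
  have h := integral_triangle_mul_boundary hb hC hGc hG hl x
  rw [integral_complex_ofReal] at h
  simp only [Function.comp]
  rw [← Complex.ofReal_re (∫ u in Set.Ioi (0 : ℝ), b u * (l * fejer (l * (u - x)))), ← h,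
    intervalIntegral.integral_of_le (by linarith), ← integral_indicator measurableSet_Ioc]
  congr 2
  ext t
  by_cases ht : t ∈ Set.Ioc (-l) l
  · simp only [Set.indicator_of_mem ht, Circle.smul_def, Real.fourierChar_apply, smul_eq_mul]
    have : ((2 * Real.pi * -(t * -(x / (2 * Real.pi))) : ℝ) : ℂ) * Complex.I = t * x * Complex.I := by
      push_cast
      have : (Real.pi : ℂ) ≠ 0 := by exact_mod_cast Real.pi_ne_zero
      field_simp
    rw [this]; ring
  · simp [Set.indicator_of_notMem ht]

end Tauberian

section TauberianTheorem

open MeasureTheory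

lemma integral_mul_fejer_comp (g : ℝ → ℝ) {l : ℝ} (hl : 0 < l) (x : ℝ) :
    ∫ u, g u * (l * fejer (l * (u - x))) = ∫ v, g (x + v / l) * fejer v := by
  have h1 := Measure.integral_comp_mul_left (fun v => g (x + v / l) * fejer v) l
  have h2 := integral_sub_right_eq_self
    (μ := volume) (fun u => g (x + l * u / l) * fejer (l * u)) x
  rw [abs_of_pos (inv_pos.2 hl), smul_eq_mul] at h1
  rw [eq_comm, inv_mul_eq_iff_eq_mul₀ hl.ne'] at h1
  rw [h1, ← h2, ← integral_const_mul]
  congr 1 with u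
  rw [mul_div_cancel_left₀ _ hl.ne', add_sub_cancel]
  ring

variable {a : ℝ → ℝ} {M : ℝ} {G : ℂ → ℂ}

lemma integrable_comp_mul_fejer (ha : Measurable a) (h0 : ∀ u, 0 ≤ a u) (hM : ∀ u, a u ≤ M)
    (l x : ℝ) : Integrable fun v => a (x + v / l) * fejer v := by
  refine integrable_fejer.bdd_mul (c := M) (Measurable.aestronglyMeasurable (by fun_prop))
    (ae_of_all _ fun v => ?_)
  rw [Real.norm_of_nonneg (h0 _)]
  exact hM _

lemma tendsto_integral_comp_mul_fejer (ha : Measurable a) (h0 : ∀ u, 0 ≤ a u) (hM : ∀ u, a u ≤ M)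
    (hneg : ∀ u ≤ 0, a u = 0) (hGc : ContinuousOn G {z | 0 ≤ z.re})
    (hG : ∀ z : ℂ, 0 < z.re →
      ∫ u in Set.Ioi (0 : ℝ), (a u : ℂ) * Complex.exp (-(z * u)) = 1 / z + G z)
    {l : ℝ} (hl : 0 < l) :
    Tendsto (fun x => ∫ v, a (x + v / l) * fejer v) atTop (𝓝 (∫ v, fejer v)) := by
  have hb : ∀ u, |a u - 1| ≤ M + 1 := fun u => by
    rw [abs_le]; constructor <;> linarith [h0 u, hM u]
  have hbG : ∀ z : ℂ, 0 < z.re →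
      ∫ u in Set.Ioi (0 : ℝ), ((a u - 1 : ℝ) : ℂ) * Complex.exp (-(z * u)) = G z := by
    intro z hz
    have he : IntegrableOn (fun u : ℝ => Complex.exp (-(z * u))) (Set.Ioi 0) := by
      simpa only [neg_mul] using integrableOn_exp_mul_complex_Ioi (a := -z) (by simpa using hz) 0
    have hi : IntegrableOn (fun u : ℝ => (a u : ℂ) * Complex.exp (-(z * u))) (Set.Ioi 0) := by
      refine Integrable.bdd_mul (c := M) he (Measurable.aestronglyMeasurable (by fun_prop))
        (ae_of_all _ fun v => ?_)
      rw [Complex.norm_real, Real.norm_of_nonneg (h0 _)]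
      exact hM _
    have hexp : ∫ u in Set.Ioi (0 : ℝ), Complex.exp (-(z * u)) = 1 / z := by
      have := integral_exp_mul_complex_Ioi (a := -z) (by simpa using hz) 0
      simpa only [neg_mul, Complex.ofReal_zero, mul_zero, neg_zero, Complex.exp_zero, neg_div_neg_eq]
        using this
    simp only [Complex.ofReal_sub, Complex.ofReal_one, sub_mul, one_mul]
    rw [integral_sub hi he, hG z hz, hexp, add_sub_cancel_left]
  have h1 := tendsto_integral_mul_fejer_of_laplace (ha.sub_const 1) hb hGc hbG hl
  have h2 : Tendsto (fun x => ∫ u in Set.Ioi (0 : ℝ), l * fejer (l * (u - x))) atTop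
      (𝓝 (∫ v, fejer v)) := by
    have e (x : ℝ) : ∫ u in Set.Ioi (0 : ℝ), l * fejer (l * (u - x)) =
        ∫ v, (Set.Ioi (0 : ℝ)).indicator 1 (x + v / l) * fejer v := by
      rw [← integral_mul_fejer_comp _ hl, ← integral_indicator measurableSet_Ioi]
      congr 1 with u
      by_cases hu : u ∈ Set.Ioi (0 : ℝ) <;> simp [hu]
    simp_rw [e]
    refine tendsto_integral_filter_of_dominated_convergence fejer ?_ ?_ integrable_fejer ?_
    · have hf := measurable_fejer
      refine Eventually.of_forall fun x => Measurable.aestronglyMeasurable (Measurable.mul ?_ hf)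
      exact (measurable_one.indicator measurableSet_Ioi).comp (by fun_prop)
    · refine Eventually.of_forall fun x => ae_of_all _ fun v => ?_
      rw [Real.norm_eq_abs, abs_mul, abs_of_nonneg (fejer_nonneg v)]
      refine mul_le_of_le_one_left (fejer_nonneg v) ?_
      by_cases hu : x + v / l ∈ Set.Ioi (0 : ℝ) <;> simp [Set.indicator, hu]
    · refine ae_of_all _ fun v => tendsto_const_nhds.congr' ?_
      filter_upwards [eventually_gt_atTop (-(v / l))] with x hx
      rw [Set.indicator_of_mem (by simp only [Set.mem_Ioi]; linarith)]
      simp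
  have h3 := h1.add h2
  rw [zero_add] at h3
  refine h3.congr fun x => ?_
  have hint := (integrable_mul_fejer hl x).integrableOn (s := Set.Ioi 0)
  have hbint : IntegrableOn (fun u => (a u - 1) * (l * fejer (l * (u - x)))) (Set.Ioi 0) :=
    Integrable.bdd_mul (c := M + 1) hint (Measurable.aestronglyMeasurable (by fun_prop))
      (ae_of_all _ hb)
  rw [← integral_add hbint hint, ← integral_mul_fejer_comp _ hl, ← integral_indicator measurableSet_Ioi]
  congr 1 with u
  by_cases hu : u ∈ Set.Ioi (0 : ℝ)
  · rw [Set.indicator_of_mem hu]; ring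
  · rw [Set.indicator_of_notMem hu, hneg u (by simpa using hu), zero_mul]

/-- A Wiener–Ikehara type Tauberian theorem. -/
theorem tendsto_one_of_laplace (ha : Measurable a) (h0 : ∀ u, 0 ≤ a u) (hM : ∀ u, a u ≤ M)
    (hneg : ∀ u ≤ 0, a u = 0) (hmono : Monotone fun u => a u * Real.exp u)
    (hGc : ContinuousOn G {z | 0 ≤ z.re})
    (hG : ∀ z : ℂ, 0 < z.re →
      ∫ u in Set.Ioi (0 : ℝ), (a u : ℂ) * Complex.exp (-(z * u)) = 1 / z + G z) :
    Tendsto a atTop (𝓝 1) := by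
  set I := ∫ v, fejer v with hI
  have hIpos : 0 < I := integral_fejer_pos
  have hM0 : 0 ≤ M := (h0 0).trans (hM 0)
  have hcompare {u v d : ℝ} (h1 : u ≤ v) (h2 : v ≤ u + d) : a u * Real.exp (-d) ≤ a v := by
    have h := hmono h1
    have h3 : a u * Real.exp (u - v) ≤ a v := by
      have := mul_le_mul_of_nonneg_right h (Real.exp_pos (-v)).le
      simp only [mul_assoc, ← Real.exp_add] at this
      simpa [sub_eq_add_neg] using this
    refine le_trans ?_ h3
    gcongr
    · exact h0 u
    · linarith
  have htrunc (δ : ℝ) (hδ : 0 < δ) :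
      ∃ R : ℝ, 0 < R ∧ (1 - δ) * I ≤ ∫ v in Set.Icc (-R) R, fejer v := by
    have h := (aecover_Icc (μ := volume) (tendsto_neg_atTop_atBot (G := ℝ))
      tendsto_id).integral_tendsto_of_countably_generated integrable_fejer
    have hlt : (1 - δ) * I < I := by nlinarith
    obtain ⟨R, h1, h2⟩ := ((h.eventually_const_lt hlt).and (eventually_gt_atTop 0)).exists
    exact ⟨R, h2, h1.le⟩
  have hmain (δ : ℝ) (hδ : 0 < δ) (hδ1 : δ < 1) : ∀ᶠ x in atTop,
      a x * (Real.exp (-(2 * δ)) * (1 - δ)) ≤ 1 + δ ∧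
        1 - δ ≤ a x * Real.exp (2 * δ) + M * δ := by
    obtain ⟨R, hR, hRI⟩ := htrunc δ hδ
    set l := R / δ with hl
    have hlpos : 0 < l := div_pos hR hδ
    have hRl : R / l = δ := by rw [hl]; field_simp
    have hJ := tendsto_integral_comp_mul_fejer ha h0 hM hneg hGc hG hlpos
    have hJint (x : ℝ) := integrable_comp_mul_fejer ha h0 hM l x
    have hup : ∀ᶠ x in atTop, ∫ v, a (x + v / l) * fejer v ≤ (1 + δ) * I :=
      hJ.eventually_le_const (by nlinarith)
    have hlo : ∀ᶠ x in atTop, (1 - δ) * I ≤ ∫ v, a (x + v / l) * fejer v :=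
      hJ.eventually_const_le (by nlinarith)
    have hbd {v : ℝ} (hv : v ∈ Set.Icc (-R) R) : -δ ≤ v / l ∧ v / l ≤ δ := by
      rw [← hRl, ← neg_div]
      exact ⟨div_le_div_of_nonneg_right hv.1 hlpos.le, div_le_div_of_nonneg_right hv.2 hlpos.le⟩
    filter_upwards [(tendsto_atTop_add_const_right atTop δ tendsto_id).eventually hup,
      (tendsto_atTop_add_const_right atTop (-δ) tendsto_id).eventually hlo] with x hx1 hx2
    simp only [id] at hx1 hx2
    constructor
    · refine le_of_mul_le_mul_right ?_ hIpos
      calc a x * (Real.exp (-(2 * δ)) * (1 - δ)) * I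
          = a x * Real.exp (-(2 * δ)) * ((1 - δ) * I) := by ring
        _ ≤ a x * Real.exp (-(2 * δ)) * ∫ v in Set.Icc (-R) R, fejer v :=
            mul_le_mul_of_nonneg_left hRI (mul_nonneg (h0 x) (Real.exp_pos _).le)
        _ = ∫ v in Set.Icc (-R) R, a x * Real.exp (-(2 * δ)) * fejer v :=
            (integral_const_mul _ _).symm
        _ ≤ ∫ v in Set.Icc (-R) R, a (x + δ + v / l) * fejer v := by
            refine setIntegral_mono_on (integrable_fejer.const_mul _).integrableOn
              (hJint _).integrableOn measurableSet_Icc fun v hv => ?_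
            refine mul_le_mul_of_nonneg_right (hcompare ?_ ?_) (fejer_nonneg v) <;>
            linarith [(hbd hv).1, (hbd hv).2]
        _ ≤ ∫ v, a (x + δ + v / l) * fejer v :=
            setIntegral_le_integral (hJint _)
              (ae_of_all _ fun v => mul_nonneg (h0 _) (fejer_nonneg v))
        _ ≤ _ := hx1
    · refine le_of_mul_le_mul_right ?_ hIpos
      refine hx2.trans ?_
      rw [← integral_add_compl (s := Set.Icc (-R) R) measurableSet_Icc (hJint _), add_mul]
      have hc := integral_add_compl (s := Set.Icc (-R) R) measurableSet_Icc integrable_fejer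
      refine add_le_add ?_ ?_
      · calc ∫ v in Set.Icc (-R) R, a (x + -δ + v / l) * fejer v
            ≤ ∫ v in Set.Icc (-R) R, a x * Real.exp (2 * δ) * fejer v := by
              refine setIntegral_mono_on (hJint _).integrableOn
                (integrable_fejer.const_mul _).integrableOn measurableSet_Icc fun v hv => ?_
              refine mul_le_mul_of_nonneg_right ?_ (fejer_nonneg v)
              have := hcompare (u := x + -δ + v / l) (v := x) (d := 2 * δ)
                (by linarith [(hbd hv).2]) (by linarith [(hbd hv).1])
              rwa [Real.exp_neg, ← div_eq_mul_inv, div_le_iff₀ (Real.exp_pos _)] at this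
          _ = a x * Real.exp (2 * δ) * ∫ v in Set.Icc (-R) R, fejer v := integral_const_mul _ _
          _ ≤ a x * Real.exp (2 * δ) * I := by
              refine mul_le_mul_of_nonneg_left ?_ (mul_nonneg (h0 x) (Real.exp_pos _).le)
              exact setIntegral_le_integral integrable_fejer (ae_of_all _ fejer_nonneg)
      · calc ∫ v in (Set.Icc (-R) R)ᶜ, a (x + -δ + v / l) * fejer v
            ≤ ∫ v in (Set.Icc (-R) R)ᶜ, M * fejer v :=
              setIntegral_mono_on (hJint _).integrableOn
                (integrable_fejer.const_mul _).integrableOn measurableSet_Icc.compl fun v _ =>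
                  mul_le_mul_of_nonneg_right (hM _) (fejer_nonneg v)
          _ = M * ∫ v in (Set.Icc (-R) R)ᶜ, fejer v := integral_const_mul _ _
          _ ≤ M * (δ * I) := mul_le_mul_of_nonneg_left (by linarith) hM0
          _ = M * δ * I := by ring
  have hsmall : ∀ᶠ δ : ℝ in 𝓝[>] 0, 0 < δ ∧ δ < 1 := by
    filter_upwards [Ioo_mem_nhdsGT (zero_lt_one' ℝ)] with δ hδ using hδ
  refine tendsto_order.2 ⟨fun c hc => ?_, fun c hc => ?_⟩
  · have hcont : Continuous fun δ : ℝ => c * Real.exp (2 * δ) + M * δ + δ := by fun_prop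
    have := (hcont.tendsto 0).eventually_lt_const (u := 1) (by simpa using hc)
    obtain ⟨δ, h1, h2⟩ := ((this.filter_mono nhdsWithin_le_nhds).and hsmall).exists
    filter_upwards [hmain δ h2.1 h2.2] with x hx
    exact lt_of_mul_lt_mul_right (by linarith [hx.2]) (Real.exp_pos (2 * δ)).le
  · have hcont : Continuous fun δ : ℝ => c * (Real.exp (-(2 * δ)) * (1 - δ)) - δ := by fun_prop
    have := (hcont.tendsto 0).eventually_const_lt (u := 1) (by simpa using hc)
    obtain ⟨δ, h1, h2⟩ := ((this.filter_mono nhdsWithin_le_nhds).and hsmall).exists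
    filter_upwards [hmain δ h2.1 h2.2] with x hx
    have hpos : 0 < Real.exp (-(2 * δ)) * (1 - δ) :=
      mul_pos (Real.exp_pos _) (by linarith [h2.2])
    exact lt_of_mul_lt_mul_right (by linarith [hx.1]) hpos.le

end TauberianTheorem

section PrimeNumberTheorem

open MeasureTheory Chebyshev ArithmeticFunction

lemma residueClass_one_eq_vonMangoldt :
    vonMangoldt.residueClass (1 : ZMod 1) = fun n => vonMangoldt n := by
  ext n
  rw [vonMangoldt.residueClass, Set.indicator_of_mem]
  exact Subsingleton.elim _ _

/-- The Laplace transform of `ψ(eᵘ) e⁻ᵘ`. -/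
lemma laplace_psi {z : ℂ} (hz : 0 < z.re) :
    ∫ u in Set.Ioi (0 : ℝ), ((psi (Real.exp u) * Real.exp (-u) : ℝ) : ℂ) * Complex.exp (-(z * u)) =
      1 / z + (vonMangoldt.LFunctionResidueClassAux (1 : ZMod 1) (1 + z) - 1) / (1 + z) := by
  have hre : 1 < (1 + z).re := by simpa using hz
  have hz0 : z ≠ 0 := by rintro rfl; simp at hz
  have hz1 : 1 + z ≠ 0 := by intro h; rw [h] at hre; simp at hre; linarith
  have hO : (fun n : ℕ ↦ ∑ k ∈ Icc 1 n, vonMangoldt k) =O[atTop] fun n ↦ (n : ℝ) ^ (1 : ℝ) := by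
    refine Asymptotics.IsBigO.of_bound (Real.log 4 + 4) (Eventually.of_forall fun n => ?_)
    have h : ∑ k ∈ Icc 1 n, vonMangoldt k = psi n := by
      rw [psi, Nat.floor_natCast, ← Icc_add_one_left_eq_Ioc, zero_add]
    rw [h, Real.rpow_one, Real.norm_of_nonneg (psi_nonneg _), Real.norm_of_nonneg n.cast_nonneg]
    exact psi_le_const_mul_self n.cast_nonneg
  have hL := LSeries_eq_mul_integral_of_nonneg (fun n => vonMangoldt n) zero_le_one
    (s := 1 + z) hre hO (fun n => vonMangoldt_nonneg)
  have haux := vonMangoldt.eqOn_LFunctionResidueClassAux (a := (1 : ZMod 1)) isUnit_one hre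
  simp only [residueClass_one_eq_vonMangoldt, Nat.totient_one, Nat.cast_one, inv_one,
    add_sub_cancel_left] at haux
  rw [hL] at haux
  have himg : Real.exp '' Set.Ioi 0 = Set.Ioi 1 := by
    ext y
    constructor
    · rintro ⟨u, hu, rfl⟩
      exact Real.one_lt_exp_iff.2 hu
    · intro hy
      exact ⟨Real.log y, Real.log_pos hy, Real.exp_log (zero_lt_one.trans hy)⟩
  have hsub := integral_image_eq_integral_abs_deriv_smul (measurableSet_Ioi (a := (0 : ℝ)))
    (fun u _ => (Real.hasDerivAt_exp u).hasDerivWithinAt) Real.exp_injective.injOn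
    (fun t : ℝ => (∑ k ∈ Icc 1 ⌊t⌋₊, (vonMangoldt k : ℂ)) * (t : ℂ) ^ (-((1 + z) + 1)))
  rw [himg] at hsub
  rw [hsub] at haux
  rw [haux]
  have hcongr : ∫ u in Set.Ioi (0 : ℝ), |Real.exp u| •
      ((∑ k ∈ Icc 1 ⌊Real.exp u⌋₊, (vonMangoldt k : ℂ)) *
        ((Real.exp u : ℝ) : ℂ) ^ (-((1 + z) + 1))) =
      ∫ u in Set.Ioi (0 : ℝ),
        ((psi (Real.exp u) * Real.exp (-u) : ℝ) : ℂ) * Complex.exp (-(z * u)) := by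
    refine integral_congr_ae (ae_of_all _ fun u => ?_)
    simp only
    have h : ∑ k ∈ Icc 1 ⌊Real.exp u⌋₊, (vonMangoldt k : ℂ) = (psi (Real.exp u) : ℂ) := by
      rw [psi, ← Icc_add_one_left_eq_Ioc, zero_add, Complex.ofReal_sum]
    have h2 : ((Real.exp u : ℝ) : ℂ) ^ (-((1 + z) + 1)) = Complex.exp (-((1 + z) + 1) * u) := by
      rw [Complex.cpow_def_of_ne_zero (by exact_mod_cast (Real.exp_pos u).ne'),
        ← Complex.ofReal_log (Real.exp_pos u).le, Real.log_exp, mul_comm]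
    rw [h, h2, Real.abs_exp, Complex.real_smul]
    push_cast
    have h3 : Complex.exp u * Complex.exp (-((1 + z) + 1) * u) =
        Complex.exp (-u) * Complex.exp (-(z * u)) := by
      rw [← Complex.exp_add, ← Complex.exp_add]; congr 1; ring
    linear_combination (psi (Real.exp u) : ℂ) * h3
  rw [hcongr]
  field_simp
  ring

/-- The prime number theorem for `ψ`, in logarithmic coordinates. -/
lemma tendsto_psi_exp_mul_exp_neg :
    Tendsto (fun u => psi (Real.exp u) * Real.exp (-u)) atTop (𝓝 1) := by
  refine tendsto_one_of_laplace (M := Real.log 4 + 4)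
    (G := fun z => (vonMangoldt.LFunctionResidueClassAux (1 : ZMod 1) (1 + z) - 1) / (1 + z))
    ?_ ?_ ?_ ?_ ?_ ?_ fun z hz => laplace_psi hz
  · exact (psi_mono.measurable.comp Real.measurable_exp).mul (by fun_prop)
  · exact fun u => mul_nonneg (psi_nonneg _) (Real.exp_pos _).le
  · intro u
    rw [Real.exp_neg, ← div_eq_mul_inv, div_le_iff₀ (Real.exp_pos u)]
    exact psi_le_const_mul_self (Real.exp_pos u).le
  · intro u hu
    rw [psi_eq_zero_of_le_one (Real.exp_le_one_iff.2 hu), zero_mul]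
  · intro u v huv
    simp only [mul_assoc, ← Real.exp_add, neg_add_cancel, Real.exp_zero, mul_one]
    exact psi_mono (Real.exp_le_exp.2 huv)
  · refine ContinuousOn.div (ContinuousOn.sub ?_ continuousOn_const) (by fun_prop) ?_
    · refine (vonMangoldt.continuousOn_LFunctionResidueClassAux (1 : ZMod 1)).comp
        (by fun_prop) fun z hz => ?_
      simpa using hz
    · intro z hz h
      have := congrArg Complex.re h
      simp at this
      have hz' : 0 ≤ z.re := hz
      linarith

lemma tendsto_psi_div : Tendsto (fun x => psi x / x) atTop (𝓝 1) := by
  refine (tendsto_psi_exp_mul_exp_neg.comp Real.tendsto_log_atTop).congr' ?_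
  filter_upwards [eventually_gt_atTop 0] with x hx
  simp only [Function.comp, Real.exp_neg, Real.exp_log hx, div_eq_mul_inv]

/-- The prime number theorem for the Chebyshev function `θ`. -/
theorem tendsto_theta_div : Tendsto (fun x => theta x / x) atTop (𝓝 1) := by
  have hsmall : Tendsto (fun x : ℝ => 2 * (Real.log x / Real.sqrt x)) atTop (𝓝 0) := by
    have := (isLittleO_log_rpow_atTop (r := 1 / 2) (by norm_num)).tendsto_div_nhds_zero
    simp only [← Real.sqrt_eq_rpow] at this
    simpa using this.const_mul 2
  have hdiff : Tendsto (fun x => psi x / x - theta x / x) atTop (𝓝 0) := by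
    refine squeeze_zero_norm' ?_ hsmall
    filter_upwards [eventually_ge_atTop 1] with x hx
    have hx0 : 0 < x := by linarith
    have hs := Real.sqrt_pos.2 hx0
    rw [← sub_div, Real.norm_eq_abs, abs_div, abs_of_pos hx0, div_le_iff₀ hx0]
    refine (abs_psi_sub_theta_le_sqrt_mul_log hx).trans (le_of_eq ?_)
    linear_combination (-(2 * Real.log x)) * Real.div_sqrt (x := x)
  simpa using tendsto_psi_div.sub hdiff

end PrimeNumberTheorem

section Characters

lemma gaussSum'_eq_gaussSum {N : ℕ} [NeZero N] (χ : DirichletCharacter ℂ N) :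
    gaussSum' χ = gaussSum χ ZMod.stdAddChar := by
  rw [gaussSum', gaussSum]
  have hN : 0 < N := Nat.pos_of_ne_zero (NeZero.ne N)
  refine Finset.sum_bij (fun b _ => (b : ZMod N)) (fun _ _ => Finset.mem_univ _) ?_ ?_ ?_
  · intro b hb c hc h
    rw [Finset.mem_Icc] at hb hc
    rw [ZMod.natCast_eq_natCast_iff'] at h
    rcases hb.2.lt_or_eq with h1 | rfl <;> rcases hc.2.lt_or_eq with h2 | h2
    · rwa [Nat.mod_eq_of_lt h1, Nat.mod_eq_of_lt h2] at h
    · rw [h2, Nat.mod_self, Nat.mod_eq_of_lt h1] at h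
      omega
    · rw [Nat.mod_self, Nat.mod_eq_of_lt h2] at h
      omega
    · exact h2.symm
  · intro a _
    rcases eq_or_ne a 0 with rfl | ha
    · exact ⟨N, Finset.mem_Icc.2 ⟨hN, le_rfl⟩, by simp⟩
    · refine ⟨a.val, Finset.mem_Icc.2 ⟨?_, (ZMod.val_lt a).le⟩, ZMod.natCast_zmod_val a⟩
      exact Nat.pos_of_ne_zero fun h => ha ((ZMod.val_eq_zero a).1 h)
  · intro b _
    have := ZMod.stdAddChar_coe (N := N) (b : ℤ)
    push_cast at this
    rw [this]

/-- The sum over odd primitive characters modulo a prime. -/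
lemma finsum_odd_div_gaussSum {N : ℕ} (hN : N.Prime) (q : ℕ) :
    ∑ᶠ χ ∈ {χ : DirichletCharacter ℂ N | χ.IsPrimitive ∧ χ (-1) = -1},
      χ (q : ZMod N) / gaussSum' χ =
    -Complex.I * ((1 - 1 / N : ℝ) * Real.sin (2 * Real.pi * q / N) : ℝ) := by
  classical
  have : Fact N.Prime := ⟨hN⟩
  have hNC : (N : ℂ) ≠ 0 := by exact_mod_cast hN.ne_zero
  by_cases hq : (q : ZMod N) = 0
  · obtain ⟨k, rfl⟩ := (ZMod.natCast_eq_zero_iff q N).1 hq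
    have hsin : Real.sin (2 * Real.pi * (N * k : ℕ) / N) = 0 := by
      have : (N : ℝ) ≠ 0 := by exact_mod_cast hN.ne_zero
      rw [show 2 * Real.pi * (N * k : ℕ) / N = (2 * k : ℕ) * Real.pi by push_cast; field_simp]
      exact Real.sin_nat_mul_pi _
    rw [hsin]
    have h0 (χ : DirichletCharacter ℂ N) : χ ((N * k : ℕ) : ZMod N) = 0 := by
      rw [hq, MulChar.map_zero]
    simp only [h0, zero_div, finsum_zero, mul_zero, Complex.ofReal_zero]
  set ψ : AddChar (ZMod N) ℂ := ZMod.stdAddChar with hψ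
  have hprim : ψ.IsPrimitive := ZMod.isPrimitive_stdAddChar N
  have hterm (χ : DirichletCharacter ℂ N) :
      (∑ᶠ (_ : χ ∈ {χ : DirichletCharacter ℂ N | χ.IsPrimitive ∧ χ (-1) = -1}),
        χ (q : ZMod N) / gaussSum' χ) =
      ∑ b : ZMod N, (2 * N : ℂ)⁻¹ * ψ⁻¹ b *
        (χ b⁻¹ * χ (q : ZMod N) - χ b⁻¹ * χ (-(q : ZMod N))) := by
    have hneg : χ (-(q : ZMod N)) = χ (-1) * χ q := by rw [← map_mul, neg_one_mul]
    have hsq : χ (-1) = 1 ∨ χ (-1) = -1 := by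
      rw [← sq_eq_one_iff, ← map_pow]; simp
    rw [finsum_eq_if]
    rcases hsq with h | h
    · rw [if_neg]
      · simp [hneg, h]
      · rintro ⟨-, h'⟩
        rw [h] at h'
        norm_num at h'
    · have hχ : χ ≠ 1 := by
        rintro rfl
        rw [MulChar.one_apply (isUnit_one.neg)] at h
        norm_num at h
      have hp : χ.IsPrimitive := by
        have hdvd := DirichletCharacter.conductor_dvd_level χ
        rcases (Nat.dvd_prime hN).1 hdvd with h1 | h1
        · exact absurd (DirichletCharacter.eq_one_iff_conductor_eq_one.2 h1) hχ
        · exact h1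
      rw [if_pos ⟨hp, h⟩, gaussSum'_eq_gaussSum]
      have hg := gaussSum_mul_gaussSum_eq_card hχ hprim
      rw [ZMod.card] at hg
      have hg0 : gaussSum χ ψ ≠ 0 := fun h0 => hNC (by rw [← hg, h0, zero_mul])
      have hinv : χ q / gaussSum χ ψ = χ q * gaussSum χ⁻¹ ψ⁻¹ / N := by
        rw [← hg]
        have : gaussSum χ⁻¹ ψ⁻¹ ≠ 0 := fun h0 => hNC (by rw [← hg, h0, mul_zero])
        field_simp
      rw [hinv, gaussSum, Finset.mul_sum, Finset.sum_div]
      refine Finset.sum_congr rfl fun b _ => ?_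
      rw [MulChar.inv_apply', hneg, h]
      field_simp
      ring
  rw [finsum_eq_sum_of_fintype, Finset.sum_congr rfl fun χ _ => hterm χ, Finset.sum_comm]
  have hinner (b : ZMod N) : ∑ χ : DirichletCharacter ℂ N, (2 * N : ℂ)⁻¹ * ψ⁻¹ b *
        (χ b⁻¹ * χ (q : ZMod N) - χ b⁻¹ * χ (-(q : ZMod N))) =
      (if b = (q : ZMod N) then (2 * N : ℂ)⁻¹ * ψ⁻¹ b * N.totient else 0) -
        (if b = -(q : ZMod N) then (2 * N : ℂ)⁻¹ * ψ⁻¹ b * N.totient else 0) := by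
    rw [← Finset.mul_sum, Finset.sum_sub_distrib]
    rcases eq_or_ne b 0 with rfl | hb
    · rw [if_neg (Ne.symm hq), if_neg (Ne.symm (neg_ne_zero.2 hq))]
      have h0 (χ : DirichletCharacter ℂ N) : χ 0 = 0 := MulChar.map_zero χ
      simp [h0]
    · rw [DirichletCharacter.sum_char_inv_mul_char_eq ℂ hb.isUnit,
        DirichletCharacter.sum_char_inv_mul_char_eq ℂ hb.isUnit]
      split_ifs <;> ring
  simp only [hinner, Finset.sum_sub_distrib, Finset.sum_ite_eq', Finset.mem_univ, if_true]
  have h1 := ZMod.stdAddChar_coe (N := N) (q : ℤ)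
  have h2 := ZMod.stdAddChar_coe (N := N) (-(q : ℤ))
  push_cast at h1 h2
  rw [AddChar.inv_apply, AddChar.inv_apply, neg_neg, h1, h2, Nat.totient_prime hN,
    Nat.cast_sub hN.one_le]
  push_cast
  rw [Complex.sin]
  rw [show 2 * Real.pi * Complex.I * (-q : ℂ) / N = -(2 * Real.pi * q / N : ℂ) * Complex.I by ring,
    show 2 * Real.pi * Complex.I * (q : ℂ) / N = (2 * Real.pi * q / N : ℂ) * Complex.I by ring]
  field_simp
  ring_nf
  simp only [Complex.I_sq]
  ring

end Characters

section PrimeSums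

open MeasureTheory Chebyshev

lemma tendsto_theta_mul_div {v : ℝ} (hv : 0 < v) :
    Tendsto (fun X : ℝ => theta (v * X) / X) atTop (𝓝 v) := by
  have h := (tendsto_theta_div.comp (tendsto_id.const_mul_atTop hv)).const_mul v
  rw [mul_one] at h
  refine h.congr fun X => ?_
  simp only [Function.comp_apply, id_eq]
  field_simp

variable {f f' : ℝ → ℝ} {c : ℝ}

lemma sum_prime_log_eq_sub_integral (hc : 1 ≤ c) (hf : ∀ x ∈ Set.Icc 1 c, HasDerivAt f (f' x) x)
    (hf' : ContinuousOn f' (Set.Icc 1 c)) {X : ℝ} (hX : 0 < X) :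
    X⁻¹ * ∑ k ∈ Ioc ⌊X⌋₊ ⌊c * X⌋₊, f (k / X) * (if k.Prime then Real.log k else 0) =
      f c * (theta (c * X) / X) - f 1 * (theta (1 * X) / X) -
        ∫ v in (1 : ℝ)..c, f' v * (theta (v * X) / X) := by
  have hXc : X ≤ c * X := le_mul_of_one_le_left hX.le hc
  have hmaps : Set.MapsTo (fun t => t / X) (Set.Icc X (c * X)) (Set.Icc 1 c) := fun t ht =>
    ⟨(one_le_div hX).2 ht.1, (div_le_iff₀ hX).2 ht.2⟩
  have hderiv (t : ℝ) (ht : t ∈ Set.Icc X (c * X)) :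
      HasDerivAt (fun t => f (t / X)) (f' (t / X) / X) t := by
    have := (hf _ (hmaps ht)).comp t ((hasDerivAt_id t).div_const X)
    simpa [Function.comp_def, div_eq_mul_inv] using this
  have hint : IntegrableOn (deriv fun t => f (t / X)) (Set.Icc X (c * X)) := by
    refine IntegrableOn.congr_fun (f := fun t => f' (t / X) / X) ?_
      (fun t ht => (hderiv t ht).deriv.symm) measurableSet_Icc
    exact ((hf'.comp (by fun_prop) hmaps).div_const X).integrableOn_Icc
  have h := sum_mul_eq_sub_sub_integral_mul (fun k : ℕ => if k.Prime then Real.log k else 0)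
    hX.le hXc (fun t ht => (hderiv t ht).differentiableAt) hint
  have htheta (t : ℝ) : ∑ k ∈ Icc 0 ⌊t⌋₊, (if k.Prime then Real.log k else 0) = theta t := by
    rw [theta_eq_sum_Icc, sum_filter]
  simp only [htheta] at h
  rw [h, mul_sub, mul_sub, one_mul]
  congr 1
  · rw [mul_div_assoc, div_self hX.ne', mul_one]
    ring
  · rw [← intervalIntegral.integral_of_le hXc]
    have hcongr : ∫ t in X..c * X, deriv (fun t => f (t / X)) t * theta t =
        ∫ t in 1 * X..c * X, f' (t / X) / X * theta (t / X * X) := by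
      rw [one_mul]
      refine intervalIntegral.integral_congr fun t ht => ?_
      rw [Set.uIcc_of_le hXc] at ht
      simp only [(hderiv t ht).deriv, div_mul_cancel₀ t hX.ne']
    rw [hcongr, ← smul_eq_mul, ← intervalIntegral.integral_comp_mul_right _ hX.ne']
    refine intervalIntegral.integral_congr fun v _ => ?_
    simp only [mul_div_cancel_right₀ v hX.ne']
    ring

/-- Prime sums of a `C¹` weight, in the limit. -/
lemma tendsto_sum_prime_log (hc : 1 ≤ c) (hf : ∀ x ∈ Set.Icc 1 c, HasDerivAt f (f' x) x)
    (hf' : ContinuousOn f' (Set.Icc 1 c)) :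
    Tendsto (fun X : ℝ => X⁻¹ * ∑ k ∈ Ioc ⌊X⌋₊ ⌊c * X⌋₊,
        f (k / X) * (if k.Prime then Real.log k else 0)) atTop
      (𝓝 (∫ x in (1 : ℝ)..c, f x)) := by
  have hparts : ∫ x in (1 : ℝ)..c, f x = f c * c - f 1 * 1 - ∫ v in (1 : ℝ)..c, f' v * v := by
    have h := intervalIntegral.integral_mul_deriv_eq_deriv_mul (u := f) (v := fun x => x)
      (u' := f') (v' := fun _ => 1) (a := 1) (b := c)
      (fun x hx => hf x (by rwa [Set.uIcc_of_le hc] at hx)) (fun x _ => hasDerivAt_id x)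
      (ContinuousOn.intervalIntegrable (by rwa [Set.uIcc_of_le hc])) (by simp)
    simpa using h
  rw [hparts]
  have hlim : Tendsto (fun X : ℝ => ∫ v in (1 : ℝ)..c, f' v * (theta (v * X) / X)) atTop
      (𝓝 (∫ v in (1 : ℝ)..c, f' v * v)) := by
    refine intervalIntegral.tendsto_integral_filter_of_dominated_convergence
      (fun v => |f' v| * (Real.log 4 * v)) ?_ ?_ ?_ ?_
    · refine Eventually.of_forall fun X => ?_
      rw [Set.uIoc_of_le hc]
      refine ((hf'.mono Set.Ioc_subset_Icc_self).aestronglyMeasurable measurableSet_Ioc).mul ?_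
      exact ((theta_mono.measurable.comp (measurable_id.mul_const X)).div_const
        X).aestronglyMeasurable
    · filter_upwards [eventually_gt_atTop 0] with X hX
      refine Eventually.of_forall fun v hv => ?_
      rw [Set.uIoc_of_le hc] at hv
      have hv0 : 0 ≤ v := zero_le_one.trans hv.1.le
      rw [norm_mul, Real.norm_eq_abs, Real.norm_eq_abs,
        abs_of_nonneg (div_nonneg (theta_nonneg _) hX.le)]
      gcongr
      rw [div_le_iff₀ hX, mul_assoc]
      exact theta_le_log4_mul_x (by positivity)
    · refine ContinuousOn.intervalIntegrable ?_
      rw [Set.uIcc_of_le hc]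
      exact hf'.abs.mul (by fun_prop)
    · refine Eventually.of_forall fun v hv => ?_
      rw [Set.uIoc_of_le hc] at hv
      exact (tendsto_theta_mul_div (zero_lt_one.trans hv.1)).const_mul _
  have hmain := (((tendsto_theta_mul_div (zero_lt_one.trans_le hc)).const_mul (f c)).sub
    ((tendsto_theta_mul_div one_pos).const_mul (f 1))).sub hlim
  refine hmain.congr' ?_
  filter_upwards [eventually_gt_atTop 0] with X hX
  exact (sum_prime_log_eq_sub_integral hc hf hf' hX).symm

lemma leastPrime_spec (x : ℝ) : (leastPrime x).Prime ∧ x ≤ leastPrime x := by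
  obtain ⟨p, hp, h⟩ := Nat.exists_infinite_primes ⌈x⌉₊
  exact Nat.sInf_mem (s := {p : ℕ | p.Prime ∧ x ≤ p}) ⟨p, h, Nat.ceil_le.1 hp⟩

lemma leastPrime_le_of_theta_lt {a b : ℝ} (h : theta a < theta b) : (leastPrime a : ℝ) ≤ b := by
  have hab : a ≤ b := (theta_mono.reflect_lt h).le
  have hb : 0 ≤ b := by
    by_contra! hb
    rw [theta_eq_zero_of_le_one (x := b) (by linarith)] at h
    exact (theta_nonneg a).not_gt h
  obtain ⟨p, hp, hpa⟩ : ∃ p ∈ (Icc 0 ⌊b⌋₊).filter Nat.Prime, a ≤ p := by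
    by_contra! hcon
    refine h.not_ge ?_
    rw [theta_eq_sum_Icc, theta_eq_sum_Icc]
    refine sum_le_sum_of_subset_of_nonneg (fun p hp => ?_) fun p _ _ => Real.log_natCast_nonneg p
    have := hcon p hp
    rw [mem_filter, mem_Icc] at hp ⊢
    exact ⟨⟨p.zero_le, Nat.le_floor this.le⟩, hp.2⟩
  rw [mem_filter, mem_Icc] at hp
  have : leastPrime a ≤ p := Nat.sInf_le ⟨hp.2, hpa⟩
  exact (Nat.cast_le.2 this).trans ((Nat.le_floor_iff hb).1 hp.1.2)

lemma tendsto_leastPrime_div {y : ℝ} (hy : 0 < y) :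
    Tendsto (fun X : ℝ => (leastPrime (y * X) : ℝ) / X) atTop (𝓝 y) := by
  rw [tendsto_order]
  constructor
  · intro a ha
    filter_upwards [eventually_gt_atTop 0] with X hX
    exact ha.trans_le ((le_div_iff₀ hX).2 (leastPrime_spec _).2)
  · intro a ha
    obtain ⟨b, hyb, hba⟩ := exists_between ha
    filter_upwards [eventually_gt_atTop 0, (tendsto_theta_mul_div hy).eventually_lt
      (tendsto_theta_mul_div (hy.trans hyb)) hyb] with X hX h
    have h := leastPrime_le_of_theta_lt ((div_lt_div_iff_of_pos_right hX).1 h)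
    exact ((div_le_iff₀ hX).2 h).trans_lt hba

end PrimeSums

section Murmuration

open Chebyshev

lemma card_mul_log_le {c X : ℝ} (hc : 0 < c) (hX : 1 < X) {P : Finset ℕ}
    (hP : ∀ N ∈ P, N.Prime ∧ X ≤ N ∧ N ≤ c * X) :
    (#P : ℝ) * Real.log X ≤ Real.log 4 * (c * X) := by
  have hcX : 0 ≤ c * X := by positivity
  refine le_trans ?_ (theta_le_log4_mul_x hcX)
  rw [theta_eq_sum_Icc, ← nsmul_eq_mul]
  refine (card_nsmul_le_sum P (fun N => Real.log N) _ fun N hN => ?_).trans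
    (sum_le_sum_of_subset_of_nonneg (fun N hN => ?_) fun N _ _ => Real.log_natCast_nonneg N)
  · exact Real.log_le_log (by linarith) (hP N hN).2.1
  · rw [mem_filter, mem_Icc]
    exact ⟨⟨N.zero_le, Nat.le_floor (hP N hN).2.2⟩, (hP N hN).1⟩

lemma abs_term_sub_le {y c X N q : ℝ} (hX : 1 < X) (hXN : X ≤ N) (hNc : N ≤ c * X) :
    |Real.log X * ((1 - 1 / N) * Real.sin (2 * Real.pi * q / N)) -
        Real.sin (2 * Real.pi * y / (N / X)) * Real.log N| ≤
      Real.log c + Real.log X / X + Real.log X * (2 * Real.pi * |q / X - y|) := by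
  have hX0 : 0 < X := by linarith
  have hN0 : 0 < N := by linarith
  have hc0 : 0 < c := pos_of_mul_pos_left (hN0.trans_le hNc) hX0.le
  have hlogX : 0 ≤ Real.log X := Real.log_nonneg hX.le
  have hlog1 : Real.log X ≤ Real.log N := Real.log_le_log hX0 hXN
  have hlog2 : Real.log N ≤ Real.log c + Real.log X := by
    rw [← Real.log_mul hc0.ne' hX0.ne']
    exact Real.log_le_log hN0 hNc
  set s := Real.sin (2 * Real.pi * q / N)
  set t := Real.sin (2 * Real.pi * y / (N / X))
  have hst : |s - t| ≤ 2 * Real.pi * |q / X - y| := by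
    refine (Real.abs_sin_sub_sin_le _ _).trans ?_
    rw [show 2 * Real.pi * q / N - 2 * Real.pi * y / (N / X) =
      2 * Real.pi * (q / X - y) * (X / N) by field_simp, abs_mul, abs_mul,
      abs_of_pos (by positivity : 0 < 2 * Real.pi), abs_of_pos (by positivity : 0 < X / N)]
    exact mul_le_of_le_one_right (by positivity) ((div_le_one hN0).2 hXN)
  have hs : |s| ≤ 1 := Real.abs_sin_le_one _
  have ht : |t| ≤ 1 := Real.abs_sin_le_one _
  rw [show Real.log X * ((1 - 1 / N) * s) - t * Real.log N =
    (Real.log X - Real.log N) * t + -(Real.log X / N * s) + Real.log X * (s - t) by ring]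
  refine (abs_add_three _ _ _).trans ?_
  rw [abs_neg, abs_mul, abs_mul, abs_mul (Real.log X), abs_of_nonneg hlogX,
    abs_of_nonneg (div_nonneg hlogX hN0.le)]
  gcongr
  · refine (mul_le_of_le_one_right (abs_nonneg _) ht).trans ?_
    rw [abs_le]
    constructor <;> linarith
  · exact (mul_le_of_le_one_right (by positivity) hs).trans (by gcongr)

lemma abs_weighted_sum_sub_le {f : ℝ → ℝ} (hf : ∀ x, |f x| ≤ 1) {c X : ℝ} (hX : 1 < X)
    (hc : 0 < c) :
    |∑ N ∈ (range (⌊c * X⌋₊ + 1)).filter (fun N : ℕ => N.Prime ∧ X ≤ N ∧ N ≤ c * X),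
        f (N / X) * Real.log N -
      ∑ k ∈ Ioc ⌊X⌋₊ ⌊c * X⌋₊, f (k / X) * (if k.Prime then Real.log k else 0)| ≤
      Real.log X := by
  have hX0 : 0 < X := by linarith
  simp only [mul_ite, mul_zero]
  rw [← sum_filter, ← sum_sdiff_eq_sub]
  · refine (abs_sum_le_sum_abs _ _).trans ?_
    refine (sum_le_sum_of_subset_of_nonneg (t := {⌊X⌋₊}) (fun N hN => ?_)
      fun _ _ _ => abs_nonneg _).trans ?_
    · simp only [Finset.mem_sdiff, Finset.mem_filter, Finset.mem_Ioc, Finset.mem_range, mem_singleton] at hN ⊢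
      have h1 := Nat.floor_le_of_le hN.1.2.2.1
      by_contra h2
      exact hN.2 ⟨⟨by omega, by omega⟩, hN.1.2.1⟩
    · rw [sum_singleton, abs_mul, abs_of_nonneg (Real.log_natCast_nonneg _)]
      refine (mul_le_of_le_one_left (Real.log_natCast_nonneg _) (hf _)).trans ?_
      exact Real.log_le_log (by exact_mod_cast Nat.floor_pos.2 hX.le) (Nat.floor_le hX0.le)
  · intro k hk
    rw [mem_filter, mem_Ioc] at hk
    rw [mem_filter, mem_range]
    exact ⟨by omega, hk.2, (Nat.lt_of_floor_lt hk.1.1).le,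
      (Nat.le_floor_iff (by positivity)).1 hk.1.2⟩

lemma Pminus_eq (y X c : ℝ) : Pminus y X c = -Complex.I * Complex.ofReal (Real.log X / X *
    ∑ N ∈ (range (⌊c * X⌋₊ + 1)).filter (fun N : ℕ => N.Prime ∧ X ≤ N ∧ N ≤ c * X),
      (1 - 1 / N) * Real.sin (2 * Real.pi * leastPrime (y * X) / N)) := by
  rw [Pminus, sum_congr rfl fun N hN =>
    finsum_odd_div_gaussSum (mem_filter.1 hN).2.1 (leastPrime (y * X)), ← mul_sum]
  push_cast
  ring

lemma tendsto_sum_sin {y c : ℝ} (hy : 0 < y) (hc : 1 < c) :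
    Tendsto (fun X : ℝ => Real.log X / X *
      ∑ N ∈ (range (⌊c * X⌋₊ + 1)).filter (fun N : ℕ => N.Prime ∧ X ≤ N ∧ N ≤ c * X),
        (1 - 1 / N) * Real.sin (2 * Real.pi * leastPrime (y * X) / N)) atTop
      (𝓝 (∫ x in (1 : ℝ)..c, Real.sin (2 * Real.pi * y / x))) := by
  have hmain := tendsto_sum_prime_log (f := fun x => Real.sin (2 * Real.pi * y / x))
    (f' := fun x => Real.cos (2 * Real.pi * y / x) * (-(2 * Real.pi * y) / x ^ 2)) hc.le
    (fun x hx => by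
      have hx0 : x ≠ 0 := (zero_lt_one.trans_le hx.1).ne'
      have h := ((hasDerivAt_const x (2 * Real.pi * y)).div (hasDerivAt_id x) hx0).sin
      simpa using h)
    (by
      have h0 : ∀ x ∈ Set.Icc 1 c, x ≠ 0 := fun x hx => (zero_lt_one.trans_le hx.1).ne'
      have h2 : ∀ x ∈ Set.Icc 1 c, x ^ 2 ≠ 0 := fun x hx => pow_ne_zero 2 (h0 x hx)
      fun_prop (disch := assumption))
  refine hmain.congr_dist ?_
  set E : ℝ → ℝ := fun X => Real.log X / X + Real.log 4 * c * (Real.log c / Real.log X + X⁻¹ +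
    2 * Real.pi * |(leastPrime (y * X) : ℝ) / X - y|)
  have hE : Tendsto E atTop (𝓝 0) := by
    have h1 : Tendsto (fun X : ℝ => Real.log X / X) atTop (𝓝 0) :=
      Real.isLittleO_log_id_atTop.tendsto_div_nhds_zero
    have h2 := Real.tendsto_log_atTop.const_div_atTop (Real.log c)
    have h3 := (((tendsto_leastPrime_div hy).sub_const y).abs).const_mul (2 * Real.pi)
    simpa using h1.add (((h2.add tendsto_inv_atTop_zero).add h3).const_mul (Real.log 4 * c))
  refine squeeze_zero' (Eventually.of_forall fun X => dist_nonneg) ?_ hE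
  filter_upwards [eventually_gt_atTop 1] with X hX
  have hX0 : 0 < X := by linarith
  have hlogX : 0 < Real.log X := Real.log_pos hX
  set q : ℝ := (leastPrime (y * X) : ℝ)
  set P := (range (⌊c * X⌋₊ + 1)).filter (fun N : ℕ => N.Prime ∧ X ≤ N ∧ N ≤ c * X)
  set B := Real.log c + Real.log X / X + Real.log X * (2 * Real.pi * |q / X - y|)
  have hB : 0 ≤ B := by
    have := Real.log_nonneg hc.le
    positivity
  have hP : ∀ N ∈ P, N.Prime ∧ X ≤ N ∧ N ≤ c * X := fun N hN => (mem_filter.1 hN).2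
  have hwt := abs_weighted_sum_sub_le (f := fun x => Real.sin (2 * Real.pi * y / x))
    (fun x => Real.abs_sin_le_one _) hX (zero_lt_one.trans hc)
  have hterm : |∑ N ∈ P, Real.log X * ((1 - 1 / N) * Real.sin (2 * Real.pi * q / N)) -
      ∑ N ∈ P, Real.sin (2 * Real.pi * y / (N / X)) * Real.log N| ≤ #P * B := by
    rw [← sum_sub_distrib, ← nsmul_eq_mul]
    exact (abs_sum_le_sum_abs _ _).trans
      (sum_le_card_nsmul P _ _ fun N hN => abs_term_sub_le hX (hP N hN).2.1 (hP N hN).2.2)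
  rw [← mul_sum] at hterm
  have hcard : #P * B ≤ Real.log 4 * (c * X) * (B / Real.log X) := by
    rw [← mul_div_assoc, le_div_iff₀ hlogX, mul_right_comm]
    exact mul_le_mul_of_nonneg_right (card_mul_log_le (zero_lt_one.trans hc) hX hP) hB
  rw [dist_comm, Real.dist_eq, div_eq_inv_mul, mul_assoc, ← mul_sub, abs_mul,
    abs_of_pos (inv_pos.2 hX0), inv_mul_le_iff₀ hX0]
  refine (abs_sub_le _ _ _).trans ((add_le_add (hterm.trans hcard) hwt).trans (le_of_eq ?_))
  simp only [E, B, q]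
  generalize |(leastPrime (y * X) : ℝ) / X - y| = r
  field_simp
  ring

end Murmuration

theorem murmuration_Pminus (y c : ℝ) (hy : 0 < y) (hc : 1 < c) :
    Tendsto (fun X : ℝ => Pminus y X c) atTop
      (𝓝 (-Complex.I *
        Complex.ofReal (∫ x in (1:ℝ)..c, Real.sin (2 * Real.pi * y / x)))) := by
  simp only [Pminus_eq]
  exact ((Complex.continuous_ofReal.tendsto _).comp (tendsto_sum_sin hy hc)).const_mul _
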